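/- Let Δ be a pure simplicial complex on [n]. If 1 is a shedding vertex of Δ such that I_{Δ_1}^∨ and I_{Δ_2}^∨ are both weakly polymatroidal, where Δ_1 = lk_Δ(1) and Δ_2 = del_Δ(1) regarded as simplicial complexes on [n]\{1}, then I_Δ^∨ is weakly polymatroidal. -/

import Mathlib

/-!
STATEMENT 13: Let `Δ` be a pure simplicial complex on `[n]` whose first vertex `1` is a
shedding vertex such that the Alexander dual ideals of `Δ₁ = lk_Δ(1)` and
`Δ₂ = del_Δ(1)` (regarded as complexes on `[n] \ {1}`) are both weakly polymatroidal.
Then `I_Δ^∨` is weakly polymatroidal.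

Here the vertex set `[n]` is modelled by `Fin (n+1)` (so it is nonempty), the
distinguished vertex `1` being `0 : Fin (n+1)`, the first variable in the ordering.
-/

open MvPolynomial

namespace Stmt

variable (K : Type) [Field K]

/-- `a` is the exponent vector of an element of the minimal monomial generating set `G(I)`
of the monomial ideal `I`: the monomial `x^a` lies in `I` and no proper monomial divisor
of it lies in `I`. -/
def IsMonoMinGen {τ : Type} (I : Ideal (MvPolynomial τ K)) (a : τ →₀ ℕ) : Prop :=
  (monomial a (1 : K)) ∈ I ∧
    ∀ b : τ →₀ ℕ, (monomial b (1 : K)) ∈ I → b ≤ a → b = a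

/-- A monomial ideal `I` (not necessarily generated in one degree) is weakly polymatroidal
with respect to a strict order `lt` on the variables (where `lt p q` means that the
variable `x_p` precedes, i.e. is greater than, the variable `x_q`):  for all exponent
vectors `a b` of minimal monomial generators `u = x^a`, `v = x^b` of `I`, if `a` and `b`
agree on all variables preceding `q` and `a q < b q`, then there is a variable `p`
coming after `q` such that `x_q · u / x_p` is again a minimal monomial generator. -/
def WeaklyPolymatroidalWrt {τ : Type} [DecidableEq τ] (lt : τ → τ → Prop)
    (I : Ideal (MvPolynomial τ K)) : Prop :=
  ∀ a b : τ →₀ ℕ, IsMonoMinGen K I a → IsMonoMinGen K I b →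
    ∀ q : τ, (∀ p, lt p q → a p = b p) → a q < b q →
      ∃ p, lt q p ∧ 0 < a p ∧
        IsMonoMinGen K I (a + Finsupp.single q 1 - Finsupp.single p 1)

/-- The collection `Δ` of finite subsets of `V` is (the set of faces of) a simplicial
complex: it is closed under passing to subsets. -/
def IsSimplicialComplex {V : Type} (Δ : Finset V → Prop) : Prop :=
  ∀ F G : Finset V, Δ F → G ⊆ F → Δ G

/-- `F` is a facet (maximal face) of `Δ`. -/
def IsFacet {V : Type} (Δ : Finset V → Prop) (F : Finset V) : Prop :=
  Δ F ∧ ∀ G, Δ G → F ⊆ G → F = G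

/-- The link of the vertex `x` in `Δ`. -/
def cplxLink {V : Type} [DecidableEq V] (Δ : Finset V → Prop) (x : V) :
    Finset V → Prop :=
  fun F => x ∉ F ∧ Δ (insert x F)

/-- The deletion of the vertex `x` from `Δ`. -/
def cplxDel {V : Type} (Δ : Finset V → Prop) (x : V) : Finset V → Prop :=
  fun F => x ∉ F ∧ Δ F

/-- Vertex decomposability of a simplicial complex: either `Δ` is a simplex, or it has a
shedding vertex `x` whose link and deletion are both vertex decomposable. -/
inductive VertexDecomposable {V : Type} [DecidableEq V] : (Finset V → Prop) → Prop
  | simplex (Δ : Finset V → Prop) (F : Finset V) (h : ∀ G, Δ G ↔ G ⊆ F) :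
      VertexDecomposable Δ
  | shed (Δ : Finset V → Prop) (x : V) (hx : Δ {x})
      (hlink : VertexDecomposable (cplxLink Δ x))
      (hdel : VertexDecomposable (cplxDel Δ x))
      (hshed : ∀ F, IsFacet (cplxLink Δ x) F → ¬ IsFacet (cplxDel Δ x) F) :
      VertexDecomposable Δ

/-- The Alexander dual ideal of `Δ`, with `Δ` regarded as a complex on the vertex set `W`:
it is generated by the monomials `∏_{v ∈ W \ F} x_v` with `F` a facet of `Δ`. -/
noncomputable def dualIdealIn {V : Type} [DecidableEq V] (W : Finset V)
    (Δ : Finset V → Prop) : Ideal (MvPolynomial V K) :=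
  Ideal.span { m | ∃ F, IsFacet Δ F ∧ m = ∏ v ∈ W \ F, X v }

/-- The Alexander dual ideal `I_Δ^∨` of the Stanley–Reisner ideal of `Δ`. -/
noncomputable def dualIdeal {V : Type} [Fintype V] [DecidableEq V]
    (Δ : Finset V → Prop) : Ideal (MvPolynomial V K) :=
  dualIdealIn K Finset.univ Δ

/-- The exponent vector of the squarefree monomial `∏_{v ∈ S} x_v`. -/
noncomputable def squarefreeExponent {V : Type} (S : Finset V) : V →₀ ℕ :=
  ∑ v ∈ S, Finsupp.single v 1

theorem squarefreeExponent_apply {V : Type} [DecidableEq V] (S : Finset V) (v : V) :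
    squarefreeExponent S v = if v ∈ S then 1 else 0 := by
  simp [squarefreeExponent, Finsupp.finsetSum_apply, Finsupp.single_apply]

theorem squarefreeExponent_le_iff {V : Type} [DecidableEq V] {S T : Finset V} :
    squarefreeExponent S ≤ squarefreeExponent T ↔ S ⊆ T := by
  simp only [Finsupp.le_def, squarefreeExponent_apply, Finset.subset_iff]
  refine forall_congr' fun v => ?_
  split_ifs <;> simp_all

theorem monomial_mem_dualIdealIn_iff {V : Type} [DecidableEq V] {W : Finset V}
    {Δ : Finset V → Prop} {a : V →₀ ℕ} :
    monomial a (1 : K) ∈ dualIdealIn K W Δ ↔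
      ∃ F, IsFacet Δ F ∧ squarefreeExponent (W \ F) ≤ a := by
  classical
  have h : { m : MvPolynomial V K | ∃ F, IsFacet Δ F ∧ m = ∏ v ∈ W \ F, X v } =
      (fun s => monomial s (1 : K)) ''
        { s | ∃ F, IsFacet Δ F ∧ s = squarefreeExponent (W \ F) } := by
    ext m
    simp only [Set.mem_ofPred_eq, Set.mem_image]
    constructor
    · rintro ⟨F, hF, rfl⟩
      exact ⟨_, ⟨F, hF, rfl⟩, monomial_sum_one _ _⟩
    · rintro ⟨_, ⟨F, hF, rfl⟩, rfl⟩
      exact ⟨F, hF, monomial_sum_one _ _⟩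
  rw [dualIdealIn, h, mem_ideal_span_monomial_image, support_monomial, if_neg one_ne_zero]
  simp only [Finset.mem_singleton, forall_eq, Set.mem_ofPred_eq]
  constructor
  · rintro ⟨_, ⟨F, hF, rfl⟩, hle⟩
    exact ⟨F, hF, hle⟩
  · rintro ⟨F, hF, hle⟩
    exact ⟨_, ⟨F, hF, rfl⟩, hle⟩

/-- The minimal generators of the Alexander dual ideal are the complements of the facets. -/
theorem isMonoMinGen_dualIdealIn_iff {V : Type} [DecidableEq V] {W : Finset V}
    {Δ : Finset V → Prop} (hW : ∀ F, Δ F → F ⊆ W) {a : V →₀ ℕ} :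
    IsMonoMinGen K (dualIdealIn K W Δ) a ↔
      ∃ F, IsFacet Δ F ∧ a = squarefreeExponent (W \ F) := by
  simp only [IsMonoMinGen, monomial_mem_dualIdealIn_iff]
  constructor
  · rintro ⟨⟨F, hF, hle⟩, hmin⟩
    exact ⟨F, hF, (hmin _ ⟨F, hF, le_rfl⟩ hle).symm⟩
  · rintro ⟨F, hF, rfl⟩
    refine ⟨⟨F, hF, le_rfl⟩, ?_⟩
    rintro b ⟨G, hG, hGb⟩ hb
    have hsub := squarefreeExponent_le_iff.1 (hGb.trans hb)
    have hFG : F ⊆ G := by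
      intro v hv
      by_contra hvG
      exact (Finset.mem_sdiff.1 (hsub (Finset.mem_sdiff.2 ⟨hW F hF.1 hv, hvG⟩))).2 hv
    obtain rfl := hF.2 G hG.1 hFG
    exact le_antisymm hb hGb

theorem exists_isFacet_superset {V : Type} [Finite V] {Δ : Finset V → Prop} {F : Finset V}
    (hF : Δ F) : ∃ G, IsFacet Δ G ∧ F ⊆ G := by
  obtain ⟨G, hFG, hG⟩ := Finite.exists_le_maximal hF
  exact ⟨G, ⟨hG.1, fun H hH hGH => le_antisymm hGH (hG.2 hH hGH)⟩, hFG⟩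

theorem isFacet_cplxLink_iff {V : Type} [DecidableEq V] {Δ : Finset V → Prop} {x : V}
    {F : Finset V} (hx : x ∉ F) : IsFacet (cplxLink Δ x) F ↔ IsFacet Δ (insert x F) := by
  constructor
  · rintro ⟨⟨-, hF⟩, hmax⟩
    refine ⟨hF, fun G hG hFG => ?_⟩
    have hxG : x ∈ G := hFG (Finset.mem_insert_self x F)
    have := hmax (G.erase x) ⟨Finset.notMem_erase x G, by rwa [Finset.insert_erase hxG]⟩
      fun v hv => Finset.mem_erase.2
        ⟨fun h => hx (h ▸ hv), hFG (Finset.mem_insert_of_mem hv)⟩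
    rw [this, Finset.insert_erase hxG]
  · rintro ⟨hF, hmax⟩
    refine ⟨⟨hx, hF⟩, fun G hG hFG => ?_⟩
    have := hmax _ hG.2 (Finset.insert_subset_insert x hFG)
    rw [← Finset.erase_insert hx, this, Finset.erase_insert hG.1]

theorem IsFacet.cplxDel {V : Type} {Δ : Finset V → Prop} {x : V} {F : Finset V}
    (hF : IsFacet Δ F) (hx : x ∉ F) : IsFacet (cplxDel Δ x) F :=
  ⟨⟨hx, hF.1⟩, fun G hG => hF.2 G hG.2⟩

theorem isFacet_of_isFacet_cplxDel {V : Type} [DecidableEq V] {Δ : Finset V → Prop}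
    (hΔ : IsSimplicialComplex Δ) {x : V}
    (hshed : ∀ F, IsFacet (cplxLink Δ x) F → ¬ IsFacet (cplxDel Δ x) F) {F : Finset V}
    (hF : IsFacet (cplxDel Δ x) F) : IsFacet Δ F := by
  refine ⟨hF.1.2, fun G hG hFG => ?_⟩
  by_cases hxG : x ∈ G
  · refine absurd hF (hshed F ⟨⟨hF.1.1, hΔ G _ hG (Finset.insert_subset hxG hFG)⟩, ?_⟩)
    exact fun H hH => hF.2 H ⟨hH.1, hΔ _ _ hH.2 (Finset.subset_insert x H)⟩
  · exact hF.2 G ⟨hxG, hG⟩ hFG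

/-- In a pure complex, a facet of the link of a shedding vertex can be completed to a facet
of the complex by a vertex other than the shedding vertex. -/
theorem exists_isFacet_insert_of_isFacet_cplxLink {V : Type} [Finite V] [DecidableEq V]
    {Δ : Finset V → Prop} (hΔ : IsSimplicialComplex Δ)
    (hpure : ∀ F G, IsFacet Δ F → IsFacet Δ G → F.card = G.card) {x : V}
    (hshed : ∀ F, IsFacet (cplxLink Δ x) F → ¬ IsFacet (cplxDel Δ x) F) {L : Finset V}
    (hL : IsFacet (cplxLink Δ x) L) :
    ∃ p, p ≠ x ∧ p ∉ L ∧ IsFacet Δ (insert p L) := by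
  have hxL : x ∉ L := hL.1.1
  have hΔL : Δ L := hΔ _ _ hL.1.2 (Finset.subset_insert x L)
  obtain ⟨G, hG, hLG⟩ := exists_isFacet_superset (Δ := cplxDel Δ x) ⟨hxL, hΔL⟩
  have hne : L ≠ G := fun h => hshed L hL (h ▸ hG)
  obtain ⟨p, hpG, hpL⟩ := Finset.exists_of_ssubset (hLG.ssubset_of_ne hne)
  have hsub : insert p L ⊆ G := Finset.insert_subset hpG hLG
  have hGΔ := isFacet_of_isFacet_cplxDel hΔ hshed hG
  have hcard := hpure _ _ hGΔ ((isFacet_cplxLink_iff hxL).1 hL)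
  have heq : insert p L = G := Finset.eq_of_subset_of_card_le hsub (by
    rw [hcard, Finset.card_insert_of_notMem hxL, Finset.card_insert_of_notMem hpL])
  exact ⟨p, fun h => hG.1.1 (h ▸ hpG), hpL, heq ▸ hGΔ⟩

theorem weaklyPolymatroidal_dualIdeal_of_sheddingVertex
    (n : ℕ) (Δ : Finset (Fin (n + 1)) → Prop)
    (hΔ : IsSimplicialComplex Δ) (hempty : Δ ∅)
    (hpure : ∀ F G, IsFacet Δ F → IsFacet Δ G → F.card = G.card)
    (hvert : Δ {0})
    (hshed : ∀ F, IsFacet (cplxLink Δ 0) F → ¬ IsFacet (cplxDel Δ 0) F)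
    (hlink : WeaklyPolymatroidalWrt K (· < ·)
      (dualIdealIn K (Finset.univ.erase 0) (cplxLink Δ 0)))
    (hdel : WeaklyPolymatroidalWrt K (· < ·)
      (dualIdealIn K (Finset.univ.erase 0) (cplxDel Δ 0))) :
    WeaklyPolymatroidalWrt K (· < ·) (dualIdeal K Δ) := by
  have hWlink : ∀ F, cplxLink Δ 0 F → F ⊆ Finset.univ.erase 0 := fun F hF v hv =>
    Finset.mem_erase.2 ⟨fun h => hF.1 (h ▸ hv), Finset.mem_univ v⟩
  have hWdel : ∀ F, cplxDel Δ 0 F → F ⊆ Finset.univ.erase 0 := fun F hF v hv =>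
    Finset.mem_erase.2 ⟨fun h => hF.1 (h ▸ hv), Finset.mem_univ v⟩
  intro a b ha hb q hq hlt
  rw [dualIdeal, isMonoMinGen_dualIdealIn_iff K fun F _ => Finset.subset_univ F] at ha hb
  simp only [dualIdeal, isMonoMinGen_dualIdealIn_iff K fun F _ => Finset.subset_univ F]
  obtain ⟨F, hF, rfl⟩ := ha
  obtain ⟨G, hG, rfl⟩ := hb
  have hcompl : ∀ S : Finset (Fin (n + 1)), 0 ∈ S →
      Finset.univ \ S = Finset.univ.erase 0 \ S.erase 0 := by
    intro S hS
    ext v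
    by_cases hv : v = 0 <;> simp [hv, hS]
  have hlinkFacet : ∀ S : Finset (Fin (n + 1)), IsFacet Δ S → 0 ∈ S →
      IsFacet (cplxLink Δ 0) (S.erase 0) := fun S hS h0 => by
    rwa [isFacet_cplxLink_iff (Finset.notMem_erase 0 S), Finset.insert_erase h0]
  rcases eq_or_ne q 0 with rfl | hq0
  · have h0F : 0 ∈ F := by
      by_contra h
      simp only [squarefreeExponent_apply] at hlt
      split_ifs at hlt <;> simp_all
    obtain ⟨p, hp0, hpF, hpΔ⟩ := exists_isFacet_insert_of_isFacet_cplxLink hΔ hpure hshed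
      (hlinkFacet F hF h0F)
    have hpF' : p ∉ F := fun h => hpF (Finset.mem_erase.2 ⟨hp0, h⟩)
    refine ⟨p, Fin.pos_iff_ne_zero.2 hp0, by simp [squarefreeExponent_apply, hpF'], _, hpΔ, ?_⟩
    ext v
    simp only [Finsupp.tsub_apply, Finsupp.add_apply, squarefreeExponent_apply,
      Finsupp.single_apply, Finset.mem_sdiff, Finset.mem_univ, true_and, Finset.mem_insert,
      Finset.mem_erase]
    by_cases hv0 : v = 0
    · subst hv0; simp [h0F, hp0, hp0.symm]
    · by_cases hvp : v = p
      · subst hvp; simp [hpF', hp0.symm]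
      · simp [hv0, hvp, Ne.symm hv0, Ne.symm hvp]
  · have h0 := hq 0 (Fin.pos_iff_ne_zero.2 hq0)
    by_cases h0F : 0 ∈ F
    · have h0G : 0 ∈ G := by
        by_contra h
        simp [squarefreeExponent_apply, h0F, h] at h0
      rw [hcompl F h0F] at hq hlt ⊢
      rw [hcompl G h0G] at hq hlt
      obtain ⟨p, hqp, hp, hgen⟩ := hlink _ _
        ((isMonoMinGen_dualIdealIn_iff K hWlink).2 ⟨_, hlinkFacet F hF h0F, rfl⟩)
        ((isMonoMinGen_dualIdealIn_iff K hWlink).2 ⟨_, hlinkFacet G hG h0G, rfl⟩) q hq hlt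
      obtain ⟨H, hH, heq⟩ := (isMonoMinGen_dualIdealIn_iff K hWlink).1 hgen
      refine ⟨p, hqp, hp, insert 0 H, (isFacet_cplxLink_iff hH.1.1).1 hH, ?_⟩
      rw [heq, hcompl _ (Finset.mem_insert_self 0 H), Finset.erase_insert hH.1.1]
    · have h0G : 0 ∉ G := by
        intro h
        simp [squarefreeExponent_apply, h0F, h] at h0
      have happly : ∀ (S : Finset (Fin (n + 1))) (v : Fin (n + 1)), v ≠ 0 →
          squarefreeExponent (Finset.univ.erase 0 \ S) v =
            squarefreeExponent (Finset.univ \ S) v := fun S v hv => by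
        simp [squarefreeExponent_apply, hv]
      obtain ⟨p, hqp, hp, hgen⟩ := hdel _ _
        ((isMonoMinGen_dualIdealIn_iff K hWdel).2 ⟨_, hF.cplxDel h0F, rfl⟩)
        ((isMonoMinGen_dualIdealIn_iff K hWdel).2 ⟨_, hG.cplxDel h0G, rfl⟩) q
        (fun v hv => by
          rcases eq_or_ne v 0 with rfl | hv0
          · simp [squarefreeExponent_apply]
          · rw [happly F v hv0, happly G v hv0, hq v hv])
        (by rwa [happly F q hq0, happly G q hq0])
      obtain ⟨H, hH, heq⟩ := (isMonoMinGen_dualIdealIn_iff K hWdel).1 hgen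
      have hp0 : p ≠ 0 := Fin.ne_zero_of_lt hqp
      refine ⟨p, hqp, by rwa [← happly F p hp0], H, isFacet_of_isFacet_cplxDel hΔ hshed hH, ?_⟩
      ext v
      rcases eq_or_ne v 0 with rfl | hv0
      · simp [squarefreeExponent_apply, h0F, hH.1.1, hq0, hp0]
      · have := DFunLike.congr_fun heq v
        simp only [Finsupp.tsub_apply, Finsupp.add_apply, happly _ v hv0] at this ⊢
        exact this

end Stmt
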